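/- arXiv:2104.12210 — 4 statements merged into one kernel-verified Lean document; each statement's English description precedes it below -/
import Mathlib

section
/- Let (X, 𝒜, μ) be a σ-finite measure space and let p_r, p_g : X → ℝ be measurable nonnegative functions with ∫ p_r dμ = ∫ p_g dμ = 1 and p_r(x) + p_g(x) > 0 for μ-almost every x. Then for every measurable function D : X → (0,1) such that x ↦ p_r(x) log D(x) and x ↦ p_g(x) log(1−D(x)) are μ-integrable, ∫ (p_r log D + p_g log(1−D)) dμ ≤ ∫ (p_r log(p_r/(p_r+p_g)) + p_g log(p_g/(p_r+p_g))) dμ, where the right-hand side is a well-defined element of [−∞, 0] since its integrand is nonpositive. In particular, the discriminator D*(x) = p_r(x)/(p_r(x)+p_g(x)) is optimal for the inner maximization of the vanilla GAN objective. -/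
open MeasureTheory

/-- A rescaled form of `log x ≤ x - 1`, valid also at `a = 0`. -/
theorem mul_log_le_mul_log_div_add {a s d : ℝ} (ha : 0 ≤ a) (hs : 0 < s) (hd : 0 < d) :
    a * Real.log d ≤ a * Real.log (a / s) + (s * d - a) := by
  rcases ha.eq_or_lt with rfl | ha
  · simpa using (mul_pos hs hd).le
  · have h := Real.log_le_sub_one_of_pos (div_pos hd (div_pos ha hs))
    rw [Real.log_div hd.ne' (div_pos ha hs).ne'] at h
    have h' := mul_le_mul_of_nonneg_left h ha.le
    have e : a * (d / (a / s) - 1) = s * d - a := by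
      field_simp
    linarith

/-- The two-point cross-entropy inequality with unnormalized weights. -/
theorem mul_log_add_mul_log_one_sub_le {a b d : ℝ} (ha : 0 ≤ a) (hb : 0 ≤ b) (hab : 0 < a + b)
    (hd : d ∈ Set.Ioo (0 : ℝ) 1) :
    a * Real.log d + b * Real.log (1 - d)
      ≤ a * Real.log (a / (a + b)) + b * Real.log (b / (a + b)) := by
  have h₁ := mul_log_le_mul_log_div_add ha hab hd.1
  have h₂ := mul_log_le_mul_log_div_add hb hab (sub_pos.2 hd.2)
  linarith

/-- Optimality of `D* = p_r / (p_r + p_g)` for the inner maximization of the vanilla GAN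
objective: on a σ-finite measure space, for nonnegative measurable densities `p_r, p_g`
integrating to `1` with `p_r + p_g > 0` a.e., and any measurable discriminator
`D : X → (0,1)` making the objective integrable, the GAN objective of `D` is bounded by
that of `D*`.  Since the integrand for `D*` is nonpositive, its (possibly `-∞`) integral
is expressed via the Lebesgue integral of its negation: the inequality
`∫ (p_r log D + p_g log (1-D)) ≤ ∫ (p_r log (p_r/(p_r+p_g)) + p_g log (p_g/(p_r+p_g)))`
is stated as `∫⁻ (negated optimal integrand) ≤ ofReal (- ∫ objective of D)`. -/
theorem stmt1 {X : Type*} [MeasurableSpace X] (μ : Measure X) [SigmaFinite μ]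
    (pr pg : X → ℝ) (hprm : Measurable pr) (hpgm : Measurable pg)
    (hpr0 : ∀ x, 0 ≤ pr x) (hpg0 : ∀ x, 0 ≤ pg x)
    (hpr1 : ∫ x, pr x ∂μ = 1) (hpg1 : ∫ x, pg x ∂μ = 1)
    (hpos : ∀ᵐ x ∂μ, 0 < pr x + pg x)
    (D : X → ℝ) (hDm : Measurable D) (hD : ∀ x, D x ∈ Set.Ioo (0 : ℝ) 1)
    (hint1 : Integrable (fun x => pr x * Real.log (D x)) μ)
    (hint2 : Integrable (fun x => pg x * Real.log (1 - D x)) μ) :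
    ∫⁻ x, ENNReal.ofReal
        (-(pr x * Real.log (pr x / (pr x + pg x))
            + pg x * Real.log (pg x / (pr x + pg x)))) ∂μ
      ≤ ENNReal.ofReal
          (-(∫ x, (pr x * Real.log (D x) + pg x * Real.log (1 - D x)) ∂μ)) := by
  have hnonneg : ∀ x, 0 ≤ -(pr x * Real.log (D x) + pg x * Real.log (1 - D x)) := fun x => by
    obtain ⟨h0, h1⟩ := hD x
    have hr := mul_nonpos_of_nonneg_of_nonpos (hpr0 x) (Real.log_nonpos h0.le h1.le)
    have hg := mul_nonpos_of_nonneg_of_nonpos (hpg0 x)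
      (Real.log_nonpos (sub_pos.2 h1).le (sub_le_self 1 h0.le))
    linarith
  have hint : Integrable
      (fun x => -(pr x * Real.log (D x) + pg x * Real.log (1 - D x))) μ := (hint1.add hint2).neg
  rw [← integral_neg, ofReal_integral_eq_lintegral_ofReal hint
    (Filter.Eventually.of_forall hnonneg)]
  refine lintegral_mono_ae ?_
  filter_upwards [hpos] with x hx
  exact ENNReal.ofReal_le_ofReal
    (neg_le_neg (mul_log_add_mul_log_one_sub_le (hpr0 x) (hpg0 x) hx (hD x)))
end

section
/- Let (X, 𝒜, μ) be a σ-finite measure space and let ℙ_r and ℙ_g be probability measures on X with densities p_r and p_g with respect to μ. Then ∫ p_r log(p_r/(p_r+p_g)) dμ + ∫ p_g log(p_g/(p_r+p_g)) dμ = −log 4 + 2·JS(ℙ_r, ℙ_g), where JS(P, Q) := ½ KL(P ‖ ½(P+Q)) + ½ KL(Q ‖ ½(P+Q)) is the Jensen–Shannon divergence and KL denotes the Kullback–Leibler divergence; both sides are well-defined elements of [−∞, −log 4] and [−log 4, +∞) respectively under the convention 0·log 0 = 0. -/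
open MeasureTheory
open scoped ENNReal Classical

/-- Kullback–Leibler divergence `KL(P‖Q) = ∫ log (dP/dQ) dP`, equal to `+∞` if `P` is not
absolutely continuous with respect to `Q` (or if the log-likelihood ratio fails to be
integrable). -/
noncomputable def klDiv {X : Type*} [MeasurableSpace X] (P Q : Measure X) : EReal :=
  if P ≪ Q ∧ Integrable (llr P Q) P then ((∫ x, llr P Q x ∂P : ℝ) : EReal) else ⊤

/-- Jensen–Shannon divergence `JS(P,Q) = ½ KL(P ‖ ½(P+Q)) + ½ KL(Q ‖ ½(P+Q))`. -/
noncomputable def jsDiv {X : Type*} [MeasurableSpace X] (P Q : Measure X) : EReal :=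
  ((1 / 2 : ℝ) : EReal) * klDiv P ((2 : ℝ≥0∞)⁻¹ • (P + Q))
    + ((1 / 2 : ℝ) : EReal) * klDiv Q ((2 : ℝ≥0∞)⁻¹ • (P + Q))

/-- The mixture of two measures with densities has the averaged density. -/
theorem half_smul_withDensity_add {X : Type*} [MeasurableSpace X] (μ : Measure X)
    {p q : X → ℝ} (hp : Measurable p) (hp0 : ∀ x, 0 ≤ p x) (hq : Measurable q)
    (hq0 : ∀ x, 0 ≤ q x) :
    (2 : ℝ≥0∞)⁻¹ • ((μ.withDensity fun x => ENNReal.ofReal (p x))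
        + μ.withDensity fun x => ENNReal.ofReal (q x))
      = μ.withDensity fun x => ENNReal.ofReal ((p x + q x) / 2) := by
  rw [← withDensity_add_left hp.ennreal_ofReal, ← withDensity_smul _
    (hp.ennreal_ofReal.add hq.ennreal_ofReal)]
  congr 1
  ext x
  rw [ENNReal.ofReal_div_of_pos two_pos, ENNReal.ofReal_add (hp0 x) (hq0 x)]
  simp [ENNReal.div_eq_inv_mul]

/-- A measure with density `p` has density `2p / (p + q)` with respect to the mixture. -/
theorem withDensity_mixture_withDensity {X : Type*} [MeasurableSpace X] (μ : Measure X)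
    {p q : X → ℝ} (hp : Measurable p) (hp0 : ∀ x, 0 ≤ p x) (hq : Measurable q)
    (hq0 : ∀ x, 0 ≤ q x) :
    (μ.withDensity fun x => ENNReal.ofReal ((p x + q x) / 2)).withDensity
        (fun x => ENNReal.ofReal (2 * (p x / (p x + q x))))
      = μ.withDensity fun x => ENNReal.ofReal (p x) := by
  rw [← withDensity_mul _ (by fun_prop) (by fun_prop)]
  congr 1
  ext x
  have h1 := hp0 x
  have h2 := hq0 x
  rw [Pi.mul_apply, ← ENNReal.ofReal_mul (by positivity)]
  congr 1
  rcases (add_nonneg h1 h2).eq_or_lt with h | h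
  · have : p x = 0 := by linarith
    simp [this]
  · field_simp

/-- Pointwise bounds for the negative log-ratio `-a log (a / (a + b))`. -/
theorem neg_mul_log_div_add_mem_Icc {a b : ℝ} (ha : 0 ≤ a) (hb : 0 ≤ b) :
    -(a * Real.log (a / (a + b))) ∈ Set.Icc 0 b := by
  rcases ha.eq_or_lt with rfl | ha
  · simp [hb]
  have hlog : -Real.log (a / (a + b)) = Real.log ((a + b) / a) := by
    rw [← Real.log_inv, inv_div]
  rw [← mul_neg, hlog]
  constructor
  · have : 1 ≤ (a + b) / a := by rw [le_div_iff₀ ha]; linarith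
    exact mul_nonneg ha.le (Real.log_nonneg this)
  · have := Real.log_le_sub_one_of_pos (show 0 < (a + b) / a by positivity)
    calc a * Real.log ((a + b) / a) ≤ a * ((a + b) / a - 1) :=
          mul_le_mul_of_nonneg_left this ha.le
      _ = b := by field_simp; ring

theorem integrable_of_isFiniteMeasure_withDensity {X : Type*} [MeasurableSpace X]
    {μ : Measure X} {p : X → ℝ} (hp : Measurable p) (hp0 : ∀ x, 0 ≤ p x)
    [IsFiniteMeasure (μ.withDensity fun x => ENNReal.ofReal (p x))] : Integrable p μ := by
  rw [← lintegral_ofReal_ne_top_iff_integrable hp.aestronglyMeasurable (ae_of_all _ hp0)]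
  have := measure_ne_top (μ.withDensity fun x => ENNReal.ofReal (p x)) Set.univ
  rwa [withDensity_apply _ MeasurableSet.univ, setLIntegral_univ] at this

theorem integrable_mul_log_div_add {X : Type*} [MeasurableSpace X] {μ : Measure X}
    {p q : X → ℝ} (hp : Measurable p) (hp0 : ∀ x, 0 ≤ p x) (hq : Integrable q μ)
    (hqm : Measurable q) (hq0 : ∀ x, 0 ≤ q x) :
    Integrable (fun x => p x * Real.log (p x / (p x + q x))) μ := by
  refine hq.mono' (by fun_prop) (ae_of_all _ fun x => ?_)
  have h := neg_mul_log_div_add_mem_Icc (hp0 x) (hq0 x)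
  rw [Real.norm_eq_abs, abs_of_nonpos (by linarith [h.1])]
  exact h.2

/-- The divergence of a probability measure with density `p` from its mixture with another
measure with density `q`. -/
theorem klDiv_mixture {X : Type*} [MeasurableSpace X] {μ : Measure X}
    {p q : X → ℝ} (hp : Measurable p) (hp0 : ∀ x, 0 ≤ p x) (hq : Measurable q)
    (hq0 : ∀ x, 0 ≤ q x)
    [IsProbabilityMeasure (μ.withDensity fun x => ENNReal.ofReal (p x))]
    [IsFiniteMeasure (μ.withDensity fun x => ENNReal.ofReal (q x))] :
    klDiv (μ.withDensity fun x => ENNReal.ofReal (p x))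
        (μ.withDensity fun x => ENNReal.ofReal ((p x + q x) / 2))
      = ((Real.log 2 + ∫ x, p x * Real.log (p x / (p x + q x)) ∂μ : ℝ) : EReal) := by
  set P := μ.withDensity fun x => ENNReal.ofReal (p x) with hP
  set M := μ.withDensity fun x => ENNReal.ofReal ((p x + q x) / 2) with hM
  have hpi : Integrable p μ := integrable_of_isFiniteMeasure_withDensity hp hp0
  have hqi : Integrable q μ := integrable_of_isFiniteMeasure_withDensity hq hq0
  have : IsFiniteMeasure M := isFiniteMeasure_withDensity_ofReal ((hpi.add hqi).div_const 2).2
  have hPM : M.withDensity (fun x => ENNReal.ofReal (2 * (p x / (p x + q x)))) = P :=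
    withDensity_mixture_withDensity μ hp hp0 hq hq0
  have hac : P ≪ M := hPM ▸ withDensity_absolutelyContinuous _ _
  have hrn : P.rnDeriv M =ᵐ[P] fun x => ENNReal.ofReal (2 * (p x / (p x + q x))) := by
    refine hac.ae_le ?_
    rw [← hPM]
    exact Measure.rnDeriv_withDensity M (by fun_prop)
  have hpos : ∀ᵐ x ∂P, 0 < p x := by
    rw [hP, ae_withDensity_iff (by fun_prop)]
    exact ae_of_all _ fun x hx => by simpa using hx
  have hllr : llr P M =ᵐ[P] fun x => Real.log 2 + Real.log (p x / (p x + q x)) := by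
    filter_upwards [hrn, hpos] with x hx hx0
    have h2 : 0 < p x / (p x + q x) := div_pos hx0 (by linarith [hq0 x])
    rw [llr, hx, ENNReal.toReal_ofReal (by positivity), Real.log_mul two_ne_zero h2.ne']
  have hmul (f : X → ℝ) : (fun x => (ENNReal.ofReal (p x)).toReal • f x) =
      fun x => p x * f x := by
    ext x
    rw [ENNReal.toReal_ofReal (hp0 x), smul_eq_mul]
  have hint : Integrable (fun x => Real.log (p x / (p x + q x))) P := by
    rw [hP, integrable_withDensity_iff_integrable_smul' (by fun_prop) (by simp), hmul]
    exact integrable_mul_log_div_add hp hp0 hqi hq hq0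
  have hval : ∫ x, Real.log (p x / (p x + q x)) ∂P
      = ∫ x, p x * Real.log (p x / (p x + q x)) ∂μ := by
    rw [hP, integral_withDensity_eq_integral_toReal_smul (by fun_prop) (by simp), hmul]
  rw [klDiv, if_pos ⟨hac, (integrable_congr hllr).2 ((integrable_const _).add hint)⟩,
    integral_congr_ae hllr, integral_add (integrable_const _) hint, hval]
  simp

/-- The Lebesgue integral of `-p log (p / (p + q))` is the negated Bochner integral. -/
theorem lintegral_neg_mul_log_div_add {X : Type*} [MeasurableSpace X] {μ : Measure X}
    {p q : X → ℝ} (hp : Measurable p) (hp0 : ∀ x, 0 ≤ p x) (hq : Integrable q μ)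
    (hqm : Measurable q) (hq0 : ∀ x, 0 ≤ q x) :
    ((∫⁻ x, ENNReal.ofReal (-(p x * Real.log (p x / (p x + q x)))) ∂μ : ℝ≥0∞) : EReal)
      = ((-∫ x, p x * Real.log (p x / (p x + q x)) ∂μ : ℝ) : EReal) := by
  have h0 : ∀ x, 0 ≤ -(p x * Real.log (p x / (p x + q x))) := fun x =>
    (neg_mul_log_div_add_mem_Icc (hp0 x) (hq0 x)).1
  have hint : Integrable (fun x => -(p x * Real.log (p x / (p x + q x)))) μ :=
    (integrable_mul_log_div_add hp hp0 hq hqm hq0).neg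
  rw [← ofReal_integral_eq_lintegral_ofReal hint (ae_of_all _ h0),
    EReal.coe_ennreal_ofReal, max_eq_left (integral_nonneg h0), integral_neg]

/-- If `ℙ_r` and `ℙ_g` are probability measures with densities `p_r`, `p_g` w.r.t. a
σ-finite measure `μ`, then
`∫ p_r log (p_r/(p_r+p_g)) dμ + ∫ p_g log (p_g/(p_r+p_g)) dμ = - log 4 + 2 JS(ℙ_r, ℙ_g)`,
where both sides are extended reals; since the integrands on the left are nonpositive,
each integral is expressed as minus the Lebesgue integral of its negation. -/
theorem stmt2 {X : Type*} [MeasurableSpace X] (μ : Measure X) [SigmaFinite μ]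
    (pr pg : X → ℝ) (hprm : Measurable pr) (hpgm : Measurable pg)
    (hpr0 : ∀ x, 0 ≤ pr x) (hpg0 : ∀ x, 0 ≤ pg x)
    (Pr Pg : Measure X)
    (hPr : Pr = μ.withDensity fun x => ENNReal.ofReal (pr x))
    (hPg : Pg = μ.withDensity fun x => ENNReal.ofReal (pg x))
    (hPr1 : IsProbabilityMeasure Pr) (hPg1 : IsProbabilityMeasure Pg) :
    (-((∫⁻ x, ENNReal.ofReal (-(pr x * Real.log (pr x / (pr x + pg x)))) ∂μ : ℝ≥0∞) : EReal))
        + (-((∫⁻ x, ENNReal.ofReal (-(pg x * Real.log (pg x / (pr x + pg x)))) ∂μ : ℝ≥0∞) : EReal))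
      = ((-Real.log 4 : ℝ) : EReal) + 2 * jsDiv Pr Pg := by
  subst hPr hPg
  have hri : Integrable pr μ := integrable_of_isFiniteMeasure_withDensity hprm hpr0
  have hgi : Integrable pg μ := integrable_of_isFiniteMeasure_withDensity hpgm hpg0
  have hlr := lintegral_neg_mul_log_div_add hprm hpr0 hgi hpgm hpg0
  have hlg := lintegral_neg_mul_log_div_add hpgm hpg0 hri hprm hpr0
  have hkr := klDiv_mixture (μ := μ) hprm hpr0 hpgm hpg0
  have hkg := klDiv_mixture (μ := μ) hpgm hpg0 hprm hpr0
  simp only [add_comm (pg _) (pr _)] at hlg hkg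
  have hlog : Real.log 4 = 2 * Real.log 2 := by
    rw [show (4 : ℝ) = 2 ^ 2 by norm_num, Real.log_pow]
    norm_num
  rw [jsDiv, half_smul_withDensity_add μ hprm hpr0 hpgm hpg0, hkr, hkg, hlr, hlg, hlog,
    show (2 : EReal) = ((2 : ℝ) : EReal) from rfl]
  norm_cast
  ring
end

section
/- For any two probability measures P and Q on a measurable space, the Jensen–Shannon divergence satisfies JS(P, Q) ≥ 0, and JS(P, Q) = 0 if and only if P = Q. Consequently, the vanilla GAN generator objective C(Q) = −log 4 + 2·JS(P, Q) attains its global minimum −log 4 exactly at Q = P. -/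
open MeasureTheory
open scoped ENNReal Classical

theorem klDiv_eq_coe_informationTheory {X : Type*} [MeasurableSpace X] (P Q : Measure X)
    [IsProbabilityMeasure P] [IsProbabilityMeasure Q] :
    klDiv P Q = ((InformationTheory.klDiv P Q : ℝ≥0∞) : EReal) := by
  by_cases h : P ≪ Q ∧ Integrable (llr P Q) P
  · rw [klDiv, if_pos h, ← InformationTheory.toReal_klDiv_of_measure_eq h.1 (by simp)]
    exact EReal.coe_ennreal_toReal (InformationTheory.klDiv_ne_top h.1 h.2)
  · rw [klDiv, if_neg h, not_ne_iff.mp (mt InformationTheory.klDiv_ne_top_iff.mp h)]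
    rfl

theorem klDiv_nonneg {X : Type*} [MeasurableSpace X] (P Q : Measure X)
    [IsProbabilityMeasure P] [IsProbabilityMeasure Q] : 0 ≤ klDiv P Q := by
  rw [klDiv_eq_coe_informationTheory]
  exact EReal.coe_ennreal_nonneg _

theorem klDiv_eq_zero_iff {X : Type*} [MeasurableSpace X] (P Q : Measure X)
    [IsProbabilityMeasure P] [IsProbabilityMeasure Q] : klDiv P Q = 0 ↔ P = Q := by
  rw [klDiv_eq_coe_informationTheory, EReal.coe_ennreal_eq_zero,
    InformationTheory.klDiv_eq_zero_iff]

theorem isProbabilityMeasure_half_smul_add {X : Type*} [MeasurableSpace X] (P Q : Measure X)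
    [IsProbabilityMeasure P] [IsProbabilityMeasure Q] :
    IsProbabilityMeasure ((2 : ℝ≥0∞)⁻¹ • (P + Q)) := by
  constructor
  simp [ENNReal.inv_two_add_inv_two]

theorem jsDiv_nonneg {X : Type*} [MeasurableSpace X] (P Q : Measure X)
    [IsProbabilityMeasure P] [IsProbabilityMeasure Q] : 0 ≤ jsDiv P Q := by
  have := isProbabilityMeasure_half_smul_add P Q
  have h_half : (0 : EReal) ≤ ((1 / 2 : ℝ) : EReal) := by
    exact_mod_cast (by norm_num : (0 : ℝ) ≤ 1 / 2)
  exact add_nonneg (mul_nonneg h_half (klDiv_nonneg _ _)) (mul_nonneg h_half (klDiv_nonneg _ _))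

theorem jsDiv_eq_zero_iff {X : Type*} [MeasurableSpace X] (P Q : Measure X)
    [IsProbabilityMeasure P] [IsProbabilityMeasure Q] : jsDiv P Q = 0 ↔ P = Q := by
  have := isProbabilityMeasure_half_smul_add P Q
  have h_half : (0 : EReal) ≤ ((1 / 2 : ℝ) : EReal) := by
    exact_mod_cast (by norm_num : (0 : ℝ) ≤ 1 / 2)
  have h_half_ne : ((1 / 2 : ℝ) : EReal) ≠ 0 := by
    exact_mod_cast (by norm_num : (1 / 2 : ℝ) ≠ 0)
  rw [jsDiv, add_eq_zero_iff_of_nonneg (mul_nonneg h_half (klDiv_nonneg _ _))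
    (mul_nonneg h_half (klDiv_nonneg _ _)), mul_eq_zero, mul_eq_zero, klDiv_eq_zero_iff,
    klDiv_eq_zero_iff]
  simp only [h_half_ne, false_or]
  refine ⟨fun h => h.1.trans h.2.symm, ?_⟩
  rintro rfl
  rw [and_self, ← two_smul ℝ≥0∞ P, smul_smul, ENNReal.inv_mul_cancel (by simp) (by simp), one_smul]

theorem EReal.coe_add_eq_coe_iff (r : ℝ) (x : EReal) : (r : EReal) + x = r ↔ x = 0 := by
  induction x with
  | bot => simp
  | top => simp
  | coe y => norm_cast; simp

/-- For any two probability measures `P` and `Q`, the Jensen–Shannon divergence satisfies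
`JS(P,Q) ≥ 0`, with `JS(P,Q) = 0` iff `P = Q`; consequently the vanilla GAN generator
objective `C(Q) = - log 4 + 2 JS(P,Q)` is bounded below by `- log 4` and attains this
global minimum exactly at `Q = P`. -/
theorem stmt3 {X : Type*} [MeasurableSpace X] (P Q : Measure X)
    [IsProbabilityMeasure P] [IsProbabilityMeasure Q] :
    0 ≤ jsDiv P Q ∧ (jsDiv P Q = 0 ↔ P = Q) ∧
      ((-Real.log 4 : ℝ) : EReal) ≤ ((-Real.log 4 : ℝ) : EReal) + 2 * jsDiv P Q ∧
      (((-Real.log 4 : ℝ) : EReal) + 2 * jsDiv P Q = ((-Real.log 4 : ℝ) : EReal) ↔ Q = P) := by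
  have h_nonneg := jsDiv_nonneg P Q
  refine ⟨h_nonneg, jsDiv_eq_zero_iff P Q, le_add_of_nonneg_right (mul_nonneg (by norm_num) h_nonneg),
    ?_⟩
  rw [EReal.coe_add_eq_coe_iff, mul_eq_zero, jsDiv_eq_zero_iff, eq_comm (a := Q)]
  simp
end

section
/- Let X be a set, let z_1, …, z_N be latent points, x_1, …, x_M true data points in X, and for a generator G : Z → X let δ^N_G = (1/N) Σ_{i=1}^N δ_{G(z_i)} and δ^M_r = (1/M) Σ_{j=1}^M δ_{x_j} be the empirical probability measures, and let J(G) := sup over D : X → (0,1) of [(1/M) Σ_j log D(x_j) + (1/N) Σ_i log(1 − D(G(z_i)))]. Let 𝒢 be any family of generators containing at least one G_0 with δ^N_{G_0} = δ^M_r. Then a generator G* ∈ 𝒢 minimizes J over 𝒢 if and only if δ^N_{G*} = δ^M_r; that is, the set of Pareto optimal generators is 𝒢^{N,*} = { G ∈ 𝒢 : δ^N_G = δ^M_r }. -/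
open MeasureTheory
open scoped ENNReal BigOperators

section Empirical

variable {X : Type*} [MeasurableSpace X]

theorem isProbabilityMeasure_empirical {n : ℕ} (hn : 0 < n) (x : Fin n → X) :
    IsProbabilityMeasure ((n : ℝ≥0∞)⁻¹ • ∑ i, Measure.dirac (x i)) := by
  constructor
  have : (n : ℝ≥0∞) ≠ 0 := by exact_mod_cast hn.ne'
  simp [ENNReal.inv_mul_cancel this (ENNReal.natCast_ne_top n)]

theorem integral_empirical [MeasurableSingletonClass X] {n : ℕ} (x : Fin n → X) (f : X → ℝ) :
    ∫ y, f y ∂((n : ℝ≥0∞)⁻¹ • ∑ i, Measure.dirac (x i)) = (1 / n : ℝ) * ∑ i, f (x i) := by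
  rw [integral_smul_measure, integral_finsetSum_measure]
  · simp
  · intro i _
    exact integrable_dirac (by simp)

theorem integrable_empirical [MeasurableSingletonClass X] {n : ℕ} (hn : 0 < n) (x : Fin n → X)
    (f : X → ℝ) : Integrable f ((n : ℝ≥0∞)⁻¹ • ∑ i, Measure.dirac (x i)) := by
  refine Integrable.smul_measure ?_ (by simpa using hn.ne')
  exact integrable_finsetSum_measure.2 fun i _ => integrable_dirac (by simp)

/-- Discriminators `X → (0,1)`. -/
abbrev Discriminator (X : Type*) := {D : X → ℝ // ∀ x, D x ∈ Set.Ioo (0 : ℝ) 1}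

/-- The GAN objective of a discriminator, for the true distribution `μ` and the generated
distribution `ν`. -/
noncomputable def ganObjective (μ ν : Measure X) (D : Discriminator X) : ℝ :=
  ∫ x, Real.log (D.1 x) ∂μ + ∫ x, Real.log (1 - D.1 x) ∂ν

theorem ganObjective_nonpos (μ ν : Measure X) (D : Discriminator X) : ganObjective μ ν D ≤ 0 := by
  refine add_nonpos (integral_nonpos fun x => ?_) (integral_nonpos fun x => ?_)
  · exact Real.log_nonpos (D.2 x).1.le (D.2 x).2.le
  · exact Real.log_nonpos (by linarith [(D.2 x).2]) (by linarith [(D.2 x).1])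

theorem bddAbove_ganObjective (μ ν : Measure X) : BddAbove (Set.range (ganObjective μ ν)) :=
  ⟨0, Set.forall_mem_range.2 (ganObjective_nonpos μ ν)⟩

theorem ganObjective_self_le (μ : Measure X) [IsProbabilityMeasure μ]
    (hint : ∀ f : X → ℝ, Integrable f μ) (D : Discriminator X) :
    ganObjective μ μ D ≤ 2 * Real.log (1 / 2) := by
  rw [ganObjective, ← integral_add (hint _) (hint _)]
  calc _ ≤ ∫ _, 2 * Real.log (1 / 2) ∂μ := by
        refine integral_mono (hint _) (hint _) fun x => ?_
        obtain ⟨h0, h1⟩ := D.2 x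
        have h1' : 0 < 1 - D.1 x := by linarith
        have key : Real.log (D.1 x * (1 - D.1 x)) ≤ Real.log (1 / 2 * (1 / 2)) :=
          Real.log_le_log (mul_pos h0 h1') (by nlinarith [sq_nonneg (D.1 x - 1 / 2)])
        rw [Real.log_mul h0.ne' h1'.ne', Real.log_mul (by norm_num) (by norm_num)] at key
        change Real.log (D.1 x) + Real.log (1 - D.1 x) ≤ _
        linarith
    _ = _ := by simp

theorem exists_mul_log_add_mul_log_pos {p q : ℝ} (hp : 0 ≤ p) (hq : 0 ≤ q) (hp1 : p ≤ 1)
    (hq1 : q ≤ 1) (hpq : p ≠ q) :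
    ∃ s ∈ Set.Ioo (-1 : ℝ) 1, 0 < p * Real.log (1 + s) + q * Real.log (1 - s) := by
  set s := (p - q) / 4 with hs
  have h1 : 0 < 1 + s := by linarith
  have h2 : 0 < 1 - s := by linarith
  refine ⟨s, ⟨by linarith, by linarith⟩, ?_⟩
  have l1 := mul_le_mul_of_nonneg_left (Real.one_sub_inv_le_log_of_pos h1) hp
  have l2 := mul_le_mul_of_nonneg_left (Real.one_sub_inv_le_log_of_pos h2) hq
  have e : p * (1 - (1 + s)⁻¹) + q * (1 - (1 - s)⁻¹)
      = (p - q) ^ 2 * (4 - p - q) / (16 * ((1 + s) * (1 - s))) := by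
    field_simp
    rw [hs]
    ring
  have : 0 < (p - q) ^ 2 * (4 - p - q) / (16 * ((1 + s) * (1 - s))) := by
    have h3 : 0 < 4 - p - q := by linarith
    have h4 : p - q ≠ 0 := sub_ne_zero.2 hpq
    positivity
  linarith

theorem integral_log_half_piecewise (μ : Measure X) [IsProbabilityMeasure μ] {A : Set X}
    (hA : MeasurableSet A) {c : ℝ} (hc : 0 < c) :
    ∫ x, Real.log (1 / 2 * (1 + A.indicator (fun _ => c - 1) x)) ∂μ
      = Real.log (1 / 2) + μ.real A * Real.log c := by
  have h : ∀ x, Real.log (1 / 2 * (1 + A.indicator (fun _ => c - 1) x))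
      = Real.log (1 / 2) + A.indicator (fun _ => Real.log c) x := by
    intro x
    by_cases hx : x ∈ A
    · simp only [Set.indicator_of_mem hx, add_sub_cancel]
      exact Real.log_mul (by norm_num) hc.ne'
    · simp [hx]
  simp_rw [h]
  rw [integral_add (integrable_const _) ((integrable_const _).indicator hA),
    integral_indicator_const _ hA]
  simp

theorem exists_lt_ganObjective (μ ν : Measure X) [IsProbabilityMeasure μ]
    [IsProbabilityMeasure ν] (h : μ ≠ ν) :
    ∃ D, 2 * Real.log (1 / 2) < ganObjective μ ν D := by
  obtain ⟨A, hA, hne⟩ : ∃ A, MeasurableSet A ∧ μ.real A ≠ ν.real A := by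
    by_contra! hcon
    exact h (Measure.ext fun A hA => (measureReal_eq_measureReal_iff).1 (hcon A hA))
  obtain ⟨s, ⟨hs1, hs2⟩, hpos⟩ := exists_mul_log_add_mul_log_pos (measureReal_nonneg (μ := μ))
    (measureReal_nonneg (μ := ν)) measureReal_le_one measureReal_le_one hne
  refine ⟨⟨fun x => 1 / 2 * (1 + A.indicator (fun _ => (1 + s) - 1) x), fun x => ?_⟩, ?_⟩
  · by_cases hx : x ∈ A
    · simp only [Set.indicator_of_mem hx]
      constructor <;> linarith
    · simp only [Set.indicator_of_notMem hx]
      constructor <;> norm_num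
  · have e : ∀ x, 1 - 1 / 2 * (1 + A.indicator (fun _ => (1 + s) - 1) x)
        = 1 / 2 * (1 + A.indicator (fun _ => (1 - s) - 1) x) := by
      intro x
      by_cases hx : x ∈ A
      · simp only [Set.indicator_of_mem hx]
        ring
      · simp only [Set.indicator_of_notMem hx]
        norm_num
    simp only [ganObjective, e]
    rw [integral_log_half_piecewise μ hA (by linarith),
      integral_log_half_piecewise ν hA (by linarith)]
    linarith

theorem le_iSup_ganObjective (μ ν : Measure X) [IsProbabilityMeasure μ]
    [IsProbabilityMeasure ν] : 2 * Real.log (1 / 2) ≤ ⨆ D, ganObjective μ ν D := by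
  refine le_ciSup_of_le (bddAbove_ganObjective μ ν)
    ⟨fun _ => 1 / 2, fun _ => by constructor <;> norm_num⟩ (le_of_eq ?_)
  have : (1 : ℝ) - 1 / 2 = 1 / 2 := by norm_num
  simp only [ganObjective, this, integral_const, probReal_univ, one_smul]
  ring

/-- The optimal-discriminator value is at most `-log 4` exactly when the distributions agree. -/
theorem iSup_ganObjective_le_iff (μ ν : Measure X) [IsProbabilityMeasure μ]
    [IsProbabilityMeasure ν] (hint : ∀ f : X → ℝ, Integrable f μ) :
    ⨆ D, ganObjective μ ν D ≤ 2 * Real.log (1 / 2) ↔ ν = μ := by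
  constructor
  · intro hle
    by_contra hne
    obtain ⟨D, hD⟩ := exists_lt_ganObjective μ ν (Ne.symm hne)
    exact absurd (hD.trans_le (le_ciSup (bddAbove_ganObjective μ ν) D)) hle.not_gt
  · rintro rfl
    have : Nonempty (Discriminator X) :=
      ⟨⟨fun _ => 1 / 2, fun _ => by constructor <;> norm_num⟩⟩
    exact ciSup_le (ganObjective_self_le ν hint)

end Empirical

/-- Pareto-optimal generators recover the empirical data distribution: with empirical
measures `δ^N_G = (1/N) Σ_i δ_{G(z_i)}` and `δ^M_r = (1/M) Σ_j δ_{x_j}` and optimal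
discriminator value
`J(G) = sup_{D : X → (0,1)} [(1/M) Σ_j log D(x_j) + (1/N) Σ_i log (1 - D(G(z_i)))]`,
if a family `𝒢` of generators contains some `G₀` with `δ^N_{G₀} = δ^M_r`, then
`G* ∈ 𝒢` minimizes `J` over `𝒢` iff `δ^N_{G*} = δ^M_r`. -/
theorem stmt7 {Z X : Type*} [MeasurableSpace X] [MeasurableSingletonClass X]
    {N M : ℕ} (hN : 0 < N) (hM : 0 < M) (z : Fin N → Z) (xs : Fin M → X)
    (𝒢 : Set (Z → X)) :
    let empG : (Z → X) → Measure X := fun G => (N : ℝ≥0∞)⁻¹ • ∑ i, Measure.dirac (G (z i))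
    let μr : Measure X := (M : ℝ≥0∞)⁻¹ • ∑ j, Measure.dirac (xs j)
    let J : (Z → X) → ℝ := fun G =>
      ⨆ D : {D : X → ℝ // ∀ x, D x ∈ Set.Ioo (0 : ℝ) 1},
        ((1 / M : ℝ) * ∑ j, Real.log (D.1 (xs j))
          + (1 / N : ℝ) * ∑ i, Real.log (1 - D.1 (G (z i))))
    (∃ G₀ ∈ 𝒢, empG G₀ = μr) →
      ∀ Gstar ∈ 𝒢, ((∀ G ∈ 𝒢, J Gstar ≤ J G) ↔ empG Gstar = μr) := by
  intro empG μr J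
  have : IsProbabilityMeasure μr := isProbabilityMeasure_empirical hM xs
  have : ∀ G, IsProbabilityMeasure (empG G) :=
    fun G => isProbabilityMeasure_empirical hN fun i => G (z i)
  have hJ : ∀ G, J G = ⨆ D, ganObjective μr (empG G) D := by
    intro G
    refine iSup_congr fun D => ?_
    rw [ganObjective, integral_empirical xs, integral_empirical fun i => G (z i)]
  have hiff : ∀ G, J G ≤ 2 * Real.log (1 / 2) ↔ empG G = μr := fun G => by
    rw [hJ]
    exact iSup_ganObjective_le_iff μr (empG G) (integrable_empirical hM xs)
  rintro ⟨G₀, hG₀, hG₀r⟩ Gstar _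
  constructor
  · intro hmin
    exact (hiff Gstar).1 ((hmin G₀ hG₀).trans ((hiff G₀).2 hG₀r))
  · intro heq G _
    refine ((hiff Gstar).2 heq).trans ?_
    rw [hJ]
    exact le_iSup_ganObjective μr (empG G)
end
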